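/- Fix r < n and distinct integers 1 < a₁ < ... < a_{r-1} < n, with a₀ = 1 and a_r = n. Fix ℓ with 1 ≤ ℓ ≤ r and a chain 0 = s₀ < s₁ < ... < s_ℓ = r. Then the number of SSYTs of shape μ ⊆ (n-1)^r with entries in {1,...,r} such that w_{s_j}(μ) = n-1-(a_{s_j} - a_{s_{j-1}}) for j = 1,...,ℓ and w_i(μ) = n-1 for all other i ∈ {1,...,r} equals the number of SSYTs of shape μ with entries in {1,...,r} such that w_i(μ) = n-1-(a_i - a_{i-1}) for all i = 1,...,r and μ contains an (i,i+1)-strip for every i ∈ {1,...,r-1} \ {s₁,...,s_{ℓ-1}}. -/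

import Mathlib

def IsPartition (r : ℕ) (μ : ℕ → ℕ) : Prop :=
  (∀ i j, i ≤ j → μ j ≤ μ i) ∧ ∀ i, r ≤ i → μ i = 0

def ZeroOutside (μ : ℕ → ℕ) (T : ℕ → ℕ → ℕ) : Prop :=
  ∀ i j, ¬ j < μ i → T i j = 0

/-- A semistandard filling of the Young diagram of `μ` (cells `(i,j)` with `j < μ i`)
with entries in `{1,…,r}`: weakly increasing along rows, strictly increasing down columns. -/
def IsSSYT (μ : ℕ → ℕ) (r : ℕ) (T : ℕ → ℕ → ℕ) : Prop :=
  (∀ i j, j < μ i → 1 ≤ T i j ∧ T i j ≤ r) ∧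
  (∀ i j k, j ≤ k → k < μ i → T i j ≤ T i k) ∧
  (∀ i j, j < μ (i + 1) → T i j < T (i + 1) j)

/-- the `v`-weight: number of boxes of `μ` filled with entry `v`. -/
noncomputable def wgt (μ : ℕ → ℕ) (T : ℕ → ℕ → ℕ) (v : ℕ) : ℕ :=
  {p : ℕ × ℕ | p.2 < μ p.1 ∧ T p.1 p.2 = v}.ncard

/-- A `(v)`-strip of width `w`: one box in each of the `w` columns, all filled with `v`,
in weakly rising (left-to-right) configuration; `f j` is the row of the box in column `j`. -/
def HasIStrip (μ : ℕ → ℕ) (w : ℕ) (T : ℕ → ℕ → ℕ) (v : ℕ) : Prop :=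
  ∃ f : ℕ → ℕ, (∀ j k, j ≤ k → k < w → f k ≤ f j) ∧
    ∀ j, j < w → j < μ (f j) ∧ T (f j) j = v

/-- `(f, m)` is a `(v,v+1)`-strip of width `w`: one box per column, entries `v` in the
first `m` columns and `v+1` thereafter, weakly rising left-to-right. -/
def IsIIStrip (μ : ℕ → ℕ) (w : ℕ) (T : ℕ → ℕ → ℕ) (v : ℕ) (f : ℕ → ℕ) (m : ℕ) : Prop :=
  m ≤ w ∧ (∀ j k, j ≤ k → k < w → f k ≤ f j) ∧ (∀ j, j < w → j < μ (f j)) ∧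
  (∀ j, j < m → T (f j) j = v) ∧ (∀ j, m ≤ j → j < w → T (f j) j = v + 1)

def HasIIStrip (μ : ℕ → ℕ) (w : ℕ) (T : ℕ → ℕ → ℕ) (v : ℕ) : Prop :=
  ∃ f m, IsIIStrip μ w T v f m

/-- 1-strip-less: no `(i)`-strip for `i ∈ {1,…,r}` and no `(i,i+1)`-strip for
`i ∈ {1,…,r-1}`. -/
def OneStripLess (μ : ℕ → ℕ) (w : ℕ) (r : ℕ) (T : ℕ → ℕ → ℕ) : Prop :=
  (∀ v, 1 ≤ v → v ≤ r → ¬ HasIStrip μ w T v) ∧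
  (∀ v, 1 ≤ v → v ≤ r - 1 → ¬ HasIIStrip μ w T v)

/-- Number of SSYTs of shape `μ` with entries in `{1,…,r}`. -/
noncomputable def ssytCount (r : ℕ) (μ : ℕ → ℕ) : ℕ :=
  {T : ℕ → ℕ → ℕ | IsSSYT μ r T ∧ ZeroOutside μ T}.ncard

/-- `μ` with its first `j` parts removed. -/
def shiftPart (μ : ℕ → ℕ) (j : ℕ) : ℕ → ℕ := fun i => μ (i + j)

/-- A standard Young tableau of shape `μ` with entries `1,…,N`. -/
def IsSYT (μ : ℕ → ℕ) (N : ℕ) (T : ℕ → ℕ → ℕ) : Prop :=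
  (∀ i j, j < μ i → 1 ≤ T i j ∧ T i j ≤ N) ∧
  (∀ i j i' j', j < μ i → j' < μ i' → T i j = T i' j' → (i, j) = (i', j')) ∧
  (∀ i j, j + 1 < μ i → T i j < T i (j + 1)) ∧
  (∀ i j, j < μ (i + 1) → T i j < T (i + 1) j)

/-- `k` is a descent of the SYT `T`: the entry `k+1` appears in a strictly lower row. -/
def IsDescent (μ : ℕ → ℕ) (T : ℕ → ℕ → ℕ) (k : ℕ) : Prop :=
  ∃ i j i' j', j < μ i ∧ j' < μ i' ∧ T i j = k ∧ T i' j' = k + 1 ∧ i < i'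

/-- number of entries `≤ v` in column `c` -/
def Nf (μ : ℕ → ℕ) (r : ℕ) (T : ℕ → ℕ → ℕ) (v c : ℕ) : ℕ :=
  ((Finset.range r).filter (fun i => c < μ i ∧ T i c ≤ v)).card

/-- column height -/
def colH (μ : ℕ → ℕ) (r : ℕ) (c : ℕ) : ℕ :=
  ((Finset.range r).filter (fun i => c < μ i)).card

structure GP (r w : ℕ) (h : ℕ → ℕ) (N : ℕ → ℕ → ℕ) : Prop where
  zero : ∀ c, c < w → N 0 c = 0
  lo : ∀ v c, v < r → c < w → N v c ≤ N (v + 1) c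
  hi : ∀ v c, v < r → c < w → N (v + 1) c ≤ N v c + 1
  anti : ∀ v c c', v ≤ r → c ≤ c' → c' < w → N v c' ≤ N v c
  top : ∀ c, c < w → N r c = h c

structure SP (r w : ℕ) (h a s : ℕ → ℕ) (l : ℕ) (N : ℕ → ℕ → ℕ) : Prop extends GP r w h N where
  cnt : ∀ i, i < r → ((Finset.range w).filter (fun c => N (i + 1) c = N i c)).card + a i = a (i + 1)
  ord : ∀ k, k < l → ∀ i i', s k ≤ i → i < i' → i' < s (k + 1) → ∀ c c', c < w → c' < w →
    N (i + 1) c = N i c → N (i' + 1) c' = N i' c' → c' < c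

lemma lt_card_filter_iff (r : ℕ) (p : ℕ → Prop) [DecidablePred p]
    (hp : ∀ i, p (i + 1) → p i) (hr : ∀ i, p i → i < r) (i : ℕ) :
    i < ((Finset.range r).filter p).card ↔ p i := by
  have down : ∀ i j, i ≤ j → p j → p i := by
    intro i j hij
    induction j, hij using Nat.le_induction with
    | base => exact id
    | succ j _ ih => exact fun h => ih (hp j h)
  constructor
  · intro h
    by_contra hn
    have : (Finset.range r).filter p ⊆ Finset.range i := by
      intro j hj
      simp only [Finset.mem_filter, Finset.mem_range] at hj ⊢
      by_contra hc
      exact hn (down i j (by omega) hj.2)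
    have := Finset.card_le_card this
    simp at this
    omega
  · intro h
    have : Finset.range (i + 1) ⊆ (Finset.range r).filter p := by
      intro j hj
      simp only [Finset.mem_filter, Finset.mem_range] at hj ⊢
      have := down j i (by omega) h
      exact ⟨hr j this, this⟩
    have := Finset.card_le_card this
    simp at this
    omega

lemma lt_Nf_iff {μ : ℕ → ℕ} {r : ℕ} {T : ℕ → ℕ → ℕ} (hp : IsPartition r μ) (hT : IsSSYT μ r T)
    (v c i : ℕ) : i < Nf μ r T v c ↔ c < μ i ∧ T i c ≤ v := by
  unfold Nf
  apply lt_card_filter_iff r (fun i => c < μ i ∧ T i c ≤ v)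
  · rintro i ⟨h1, h2⟩
    have := hp.1 i (i + 1) (by omega)
    have := hT.2.2 i c h1
    exact ⟨by omega, by omega⟩
  · rintro i ⟨h1, _⟩
    by_contra hc
    have := hp.2 i (by omega)
    omega

lemma lt_colH_iff {μ : ℕ → ℕ} {r : ℕ} (hp : IsPartition r μ) 
    (c i : ℕ) : i < colH μ r c ↔ c < μ i := by
  unfold colH
  apply lt_card_filter_iff r (fun i => c < μ i)
  · rintro i h1
    have := hp.1 i (i + 1) (by omega)
    omega
  · rintro i h1
    by_contra hc
    have := hp.2 i (by omega)
    omega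

lemma gp_Nf {μ : ℕ → ℕ} {r w : ℕ} {T : ℕ → ℕ → ℕ} (hp : IsPartition r μ) (hT : IsSSYT μ r T) :
    GP r w (colH μ r) (Nf μ r T) := by
  have K := lt_Nf_iff hp hT
  refine ⟨?_, ?_, ?_, ?_, ?_⟩
  · intro c _
    by_contra hc
    have := (K 0 c 0).1 (by omega)
    have := hT.1 0 c this.1
    omega
  · intro v c _ _
    by_contra hc
    have h1 := (K v c (Nf μ r T (v + 1) c)).1 (by omega)
    have := (K (v + 1) c (Nf μ r T (v + 1) c)).2 ⟨h1.1, by omega⟩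
    omega
  · intro v c _ _
    by_contra hc
    have h1 := (K (v + 1) c (Nf μ r T v c + 1)).1 (by omega)
    have h2 := hT.2.2 _ _ h1.1
    have h3 := hp.1 (Nf μ r T v c) (Nf μ r T v c + 1) (Nat.le_succ _)
    have := (K v c (Nf μ r T v c)).2 ⟨by omega, by omega⟩
    omega
  · intro v c c' _ hcc _
    by_contra hc
    have h1 := (K v c' (Nf μ r T v c)).1 (by omega)
    have h2 := hT.2.1 _ c c' hcc h1.1
    have := (K v c (Nf μ r T v c)).2 ⟨by omega, by omega⟩
    omega
  · intro c _
    apply le_antisymm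
    · by_contra hc
      have h1 := (K r c (colH μ r c)).1 (by omega)
      have := (lt_colH_iff hp c _).2 h1.1
      omega
    · by_contra hc
      have h1 := (lt_colH_iff hp c (Nf μ r T r c)).1 (by omega)
      have := (K r c (Nf μ r T r c)).2 ⟨h1, (hT.1 _ _ h1).2⟩
      omega

lemma Nf_inj {μ : ℕ → ℕ} {r w : ℕ} {T T' : ℕ → ℕ → ℕ} (hp : IsPartition r μ) (hsub : ∀ i, μ i ≤ w)
    (hT : IsSSYT μ r T) (hT' : IsSSYT μ r T') (hz : ZeroOutside μ T) (hz' : ZeroOutside μ T')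
    (h : ∀ v c, v ≤ r → c < w → Nf μ r T v c = Nf μ r T' v c) : T = T' := by
  funext i c
  by_cases hc : c < μ i
  · have hw := hsub i
    have b := hT.1 i c hc
    have b' := hT'.1 i c hc
    apply le_antisymm
    · have h1 := (lt_Nf_iff hp hT' (T' i c) c i).2 ⟨hc, le_rfl⟩
      rw [← h _ _ (by omega) (by omega)] at h1
      exact ((lt_Nf_iff hp hT _ _ _).1 h1).2
    · have h1 := (lt_Nf_iff hp hT (T i c) c i).2 ⟨hc, le_rfl⟩
      rw [h _ _ (by omega) (by omega)] at h1
      exact ((lt_Nf_iff hp hT' _ _ _).1 h1).2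
  · rw [hz i c hc, hz' i c hc]

lemma exists_of_gp {μ : ℕ → ℕ} {r w : ℕ} {N : ℕ → ℕ → ℕ} (hp : IsPartition r μ)
    (hsub : ∀ i, μ i ≤ w) (hN : GP r w (colH μ r) N) :
    ∃ T, IsSSYT μ r T ∧ ZeroOutside μ T ∧ ∀ v c, v ≤ r → c < w → Nf μ r T v c = N v c := by
  classical
  have mono : ∀ c, c < w → ∀ v v', v ≤ v' → v' ≤ r → N v c ≤ N v' c := by
    intro c hc v v' hv
    induction v', hv using Nat.le_induction with
    | base => intro _; exact le_rfl
    | succ v' _ ih => intro h; exact (ih (by omega)).trans (hN.lo v' c (by omega) hc)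
  have htop : ∀ i c, c < μ i → i < N r c := by
    intro i c hc
    have := hsub i
    rw [hN.top c (by omega)]
    exact (lt_colH_iff hp c i).2 hc
  let R : ℕ → ℕ → ℕ := fun i c => ((Finset.range r).filter (fun v => N v c ≤ i)).card
  have hR : ∀ i c v, c < μ i → (v < R i c ↔ (v < r ∧ N v c ≤ i)) := by
    intro i c v hc
    have hcw : c < w := lt_of_lt_of_le hc (hsub i)
    have := lt_card_filter_iff r (fun v => v < r ∧ N v c ≤ i)
      (fun v h => ⟨by omega, (mono c hcw v (v+1) (by omega) (by omega)).trans h.2⟩) (fun v h => h.1) v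
    rw [← this]
    have e : (Finset.range r).filter (fun v => N v c ≤ i) =
        (Finset.range r).filter (fun v => v < r ∧ N v c ≤ i) := by
      apply Finset.filter_congr
      intro x hx
      simp at hx
      simp [hx]
    simp only [R, e]
  have hRr : ∀ i c, R i c ≤ r := by
    intro i c
    exact (Finset.card_filter_le _ _).trans (by simp)
  have hR1 : ∀ i c, c < μ i → 1 ≤ R i c := by
    intro i c hc
    have hcw : c < w := lt_of_lt_of_le hc (hsub i)
    have h0 := hN.zero c hcw
    have h1 := htop i c hc
    have : 0 < r := by
      rcases Nat.eq_zero_or_pos r with h | h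
      · rw [h] at h1; omega
      · exact h
    exact (hR i c 0 hc).2 ⟨this, by omega⟩
  have hRgt : ∀ i c, c < μ i → i < N (R i c) c := by
    intro i c hc
    rcases (hRr i c).lt_or_eq with h | h
    · by_contra hn
      have := (hR i c (R i c) hc).2 ⟨h, by omega⟩
      omega
    · rw [h]; exact htop i c hc
  have hRle : ∀ i c v, c < μ i → v ≤ r → (R i c ≤ v ↔ i < N v c) := by
    intro i c v hc hv
    have hcw : c < w := lt_of_lt_of_le hc (hsub i)
    constructor
    · intro h
      exact (hRgt i c hc).trans_le (mono c hcw _ _ h hv)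
    · intro h
      by_contra hn
      have := (hR i c v hc).1 (by omega)
      omega
  have hT : IsSSYT μ r (fun i c => if c < μ i then R i c else 0) := by
    refine ⟨?_, ?_, ?_⟩
    · intro i c hc
      simp only [hc, if_true]
      exact ⟨hR1 i c hc, hRr i c⟩
    · intro i c c' hcc hc'
      have hcw : c' < w := lt_of_lt_of_le hc' (hsub i)
      have hc : c < μ i := by omega
      simp only [hc, hc', if_true]
      rw [hRle i c _ hc (hRr _ _)]
      exact (hRgt i c' hc').trans_le (hN.anti _ _ _ (hRr _ _) hcc hcw)
    · intro i c hc1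
      have hc : c < μ i := hc1.trans_le (hp.1 i (i+1) (by omega))
      have hcw : c < w := lt_of_lt_of_le hc (hsub i)
      simp only [hc, hc1, if_true]
      obtain ⟨u, hu⟩ : ∃ u, R (i+1) c = u + 1 := ⟨R (i+1) c - 1, by have := hR1 (i+1) c hc1; omega⟩
      have h1 := hRgt (i+1) c hc1
      rw [hu] at h1 ⊢
      have hur := hRr (i+1) c
      have h2 := hN.hi u c (by omega) hcw
      have := (hRle i c u hc (by omega)).2 (by omega)
      omega
  refine ⟨fun i c => if c < μ i then R i c else 0, hT, ?_, ?_⟩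
  · intro i c hc
    simp [hc]
  · intro v c hv hcw
    have key : ∀ i, i < Nf μ r (fun i c => if c < μ i then R i c else 0) v c ↔ i < N v c := by
      intro i
      rw [lt_Nf_iff hp hT]
      constructor
      · rintro ⟨h1, h2⟩
        simp only [h1, if_true] at h2
        exact (hRle i c v h1 hv).1 h2
      · intro h
        have h1 : c < μ i := by
          rw [← lt_colH_iff hp, ← hN.top c hcw]
          exact h.trans_le (mono c hcw _ _ hv le_rfl)
        refine ⟨h1, ?_⟩
        simp only [h1, if_true]
        exact (hRle i c v h1 hv).2 h
    apply le_antisymm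
    · by_contra hc
      exact absurd ((key (N v c)).1 (by omega)) (lt_irrefl _)
    · by_contra hc
      exact absurd ((key _).2 (not_le.1 hc)) (lt_irrefl _)

lemma T_eq_iff {μ : ℕ → ℕ} {r : ℕ} {T : ℕ → ℕ → ℕ} (hp : IsPartition r μ) (hT : IsSSYT μ r T)
    (v c i : ℕ) : (c < μ i ∧ T i c = v + 1) ↔ Nf μ r T v c ≤ i ∧ i < Nf μ r T (v + 1) c := by
  have h1 := lt_Nf_iff hp hT v c i
  have h2 := lt_Nf_iff hp hT (v+1) c i
  constructor
  · rintro ⟨h, e⟩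
    refine ⟨?_, h2.2 ⟨h, by omega⟩⟩
    by_contra hc
    have := h1.1 (by omega)
    omega
  · rintro ⟨h, e⟩
    have := h2.1 e
    refine ⟨this.1, ?_⟩
    by_contra hc
    have := h1.2 ⟨this.1, by omega⟩
    omega

lemma wgt_add {μ : ℕ → ℕ} {r w : ℕ} {T : ℕ → ℕ → ℕ} (hp : IsPartition r μ) (hsub : ∀ i, μ i ≤ w)
    (hT : IsSSYT μ r T) (i : ℕ) (hi : i < r) :
    wgt μ T (i + 1) +
      ((Finset.range w).filter (fun c => Nf μ r T (i + 1) c = Nf μ r T i c)).card = w := by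
  have hG := gp_Nf (w := w) hp hT
  have e : {p : ℕ × ℕ | p.2 < μ p.1 ∧ T p.1 p.2 = i + 1} =
      (((Finset.range w).filter (fun c => ¬ Nf μ r T (i + 1) c = Nf μ r T i c)).image
        (fun c => (Nf μ r T i c, c)) : Finset (ℕ × ℕ)) := by
    ext ⟨x, c⟩
    simp only [Set.mem_ofPred_eq, Finset.coe_image, Set.mem_image, Finset.mem_coe, Finset.mem_filter,
      Finset.mem_range, Prod.mk.injEq]
    rw [T_eq_iff hp hT]
    constructor
    · rintro ⟨h1, h2⟩
      have hx := (lt_Nf_iff hp hT _ _ _).1 h2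
      have hcw : c < w := hx.1.trans_le (hsub x)
      have := hG.hi i c hi hcw
      exact ⟨c, ⟨hcw, by omega⟩, by omega, rfl⟩
    · rintro ⟨c', ⟨hcw, h1⟩, h2, rfl⟩
      have := hG.hi i c' hi hcw
      have := hG.lo i c' hi hcw
      omega
  unfold wgt
  rw [e, Set.ncard_coe_finset, Finset.card_image_of_injective _ (by intro x y h; simpa using (Prod.mk.inj h).2)]
  rw [add_comm, Finset.card_filter_add_card_filter_not]
  simp

lemma strip_iff {μ : ℕ → ℕ} {r w : ℕ} {T : ℕ → ℕ → ℕ} (hp : IsPartition r μ)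
    (hT : IsSSYT μ r T) (i : ℕ) (hi : i + 1 < r) :
    HasIIStrip μ w T (i + 1) ↔ ∀ c c', c < w → c' < w → Nf μ r T (i + 1) c = Nf μ r T i c →
      Nf μ r T (i + 2) c' = Nf μ r T (i + 1) c' → c' < c := by
  have hG := gp_Nf (w := w) hp hT
  constructor
  · rintro ⟨f, m, hm, hf, hμ, h1, h2⟩ c c' hc hc' e e'
    have a1 : m ≤ c := by
      by_contra hn
      have := (T_eq_iff hp hT i c (f c)).1 ⟨hμ c hc, h1 c (by omega)⟩
      omega
    have a2 : c' < m := by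
      by_contra hn
      have := (T_eq_iff hp hT (i+1) c' (f c')).1 ⟨hμ c' hc', h2 c' (by omega) hc'⟩
      have e2 : i + 1 + 1 = i + 2 := rfl
      rw [e2] at this
      omega
    omega
  · intro h
    -- the minimal switching column
    have hm : ∃ m, m ≤ w ∧ (∀ c, c < w → Nf μ r T (i + 2) c = Nf μ r T (i + 1) c → c < m) ∧
        (m = 0 ∨ ∃ c, c + 1 = m ∧ Nf μ r T (i + 2) c = Nf μ r T (i + 1) c) := by
      classical
      let P : ℕ → Prop := fun m => ∀ c, c < w → Nf μ r T (i + 2) c = Nf μ r T (i + 1) c → c < m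
      have ex : ∃ m, P m := ⟨w, fun c hc _ => hc⟩
      refine ⟨Nat.find ex, Nat.find_le (fun c hc _ => hc), Nat.find_spec ex, ?_⟩
      rcases Nat.eq_zero_or_pos (Nat.find ex) with h0 | h0
      · exact Or.inl h0
      · right
        have h2 : ¬ P (Nat.find ex - 1) := Nat.find_min ex (by omega)
        simp only [P, not_forall] at h2
        obtain ⟨c, hc, e, h3⟩ := h2
        have := Nat.find_spec ex c hc e
        exact ⟨c, by omega, e⟩
    obtain ⟨m, hmw, hm1, hm2⟩ := hm
    have has1 : ∀ c, c < m → Nf μ r T (i + 1) c = Nf μ r T i c + 1 := by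
      intro c hc
      have b1 := hG.lo i c (by omega) (by omega)
      have b2 := hG.hi i c (by omega) (by omega)
      rcases hm2 with h0 | ⟨c', h1, h2⟩
      · omega
      · by_contra hn
        have := h c c' (by omega) (by omega) (by omega) h2
        omega
    have has2 : ∀ c, m ≤ c → c < w → Nf μ r T (i + 2) c = Nf μ r T (i + 1) c + 1 := by
      intro c hc hcw
      have b1 : _ ≤ Nf μ r T (i + 2) c := hG.lo (i+1) c (by omega) (by omega)
      have b2 : Nf μ r T (i + 2) c ≤ _ := hG.hi (i+1) c (by omega) (by omega)
      by_contra hn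
      have := hm1 c hcw (by omega)
      omega
    have t1 : ∀ c, c < m → c < μ (Nf μ r T i c) ∧ T (Nf μ r T i c) c = i + 1 := by
      intro c hc
      rw [T_eq_iff hp hT, has1 c hc]
      omega
    have t2 : ∀ c, m ≤ c → c < w →
        c < μ (Nf μ r T (i+1) c) ∧ T (Nf μ r T (i+1) c) c = i + 1 + 1 := by
      intro c hc hcw
      rw [T_eq_iff hp hT]
      have := has2 c hc hcw
      have e2 : i + 1 + 1 = i + 2 := rfl
      rw [e2]
      omega
    refine ⟨fun c => if c < m then Nf μ r T i c else Nf μ r T (i + 1) c, m, hmw, ?_, ?_, ?_, ?_⟩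
    · intro c c' hcc hc'
      have g1 := hG.anti i c c' (by omega) hcc hc'
      have g2 := hG.anti (i+1) c c' (by omega) hcc hc'
      by_cases k1 : c < m <;> by_cases k2 : c' < m
      · simp [k1, k2, g1]
      · simp only [k1, k2, if_true, if_false]
        rcases hm2 with h0 | ⟨d, h1, h2⟩
        · omega
        · have q1 := hG.anti (i+2) d c' (by omega) (by omega) hc'
          have q2 := hG.anti i c d (by omega) (by omega) (by omega)
          have q3 := has1 d (by omega)
          have q4 := has2 c' (by omega) hc'
          omega
      · omega
      · simp [k1, k2, g2]
    · intro c hc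
      by_cases k : c < m
      · simp only [k, if_true]; exact (t1 c k).1
      · simp only [k, if_false]; exact (t2 c (by omega) hc).1
    · intro c k
      simp only [k, if_true]; exact (t1 c k).2
    · intro c k hc
      have k' : ¬ c < m := by omega
      simp only [k', if_false]; exact (t2 c k hc).2

def rk (M : Finset ℕ) (c : ℕ) : ℕ := (M.filter (fun x => x < c)).card

lemma rk_mono (M : Finset ℕ) {c c' : ℕ} (h : c ≤ c') : rk M c ≤ rk M c' := by
  apply Finset.card_le_card
  intro x
  simp only [Finset.mem_filter]
  rintro ⟨h1, h2⟩
  exact ⟨h1, by omega⟩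

lemma rk_strict (M : Finset ℕ) {c c' : ℕ} (hc : c ∈ M) (h : c < c') : rk M c < rk M c' := by
  apply Finset.card_lt_card
  rw [Finset.ssubset_iff_of_subset]
  · exact ⟨c, by simp [hc, h], by simp⟩
  · intro x
    simp only [Finset.mem_filter]
    rintro ⟨h1, h2⟩
    exact ⟨h1, by omega⟩

lemma rk_lt (M : Finset ℕ) {c : ℕ} (hc : c ∈ M) : rk M c < M.card := by
  apply Finset.card_lt_card
  rw [Finset.ssubset_iff_of_subset (Finset.filter_subset _ _)]
  exact ⟨c, hc, by simp⟩

lemma rk_count (M : Finset ℕ) (p q : ℕ) (hq : q ≤ M.card) :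
    (M.filter (fun c => p ≤ rk M c ∧ rk M c < q)).card = q - p := by
  have inj : Set.InjOn (rk M) (M : Set ℕ) := by
    intro x hx y hy e
    rcases lt_trichotomy x y with h | h | h
    · have := rk_strict M (Finset.mem_coe.1 hx) h; omega
    · exact h
    · have := rk_strict M (Finset.mem_coe.1 hy) h; omega
  have im : M.image (rk M) = Finset.range M.card := by
    apply Finset.eq_of_subset_of_card_le
    · intro x hx
      obtain ⟨c, hc, rfl⟩ := Finset.mem_image.1 hx
      exact Finset.mem_range.2 (rk_lt M hc)
    · rw [Finset.card_image_of_injOn inj]; simp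
  have im2 : (M.filter (fun c => p ≤ rk M c ∧ rk M c < q)).image (rk M) = Finset.Ico p q := by
    ext x
    simp only [Finset.mem_image, Finset.mem_filter, Finset.mem_Ico]
    constructor
    · rintro ⟨c, ⟨_, h⟩, rfl⟩; exact h
    · intro h
      have : x ∈ M.image (rk M) := by rw [im]; simp; omega
      obtain ⟨c, hc, rfl⟩ := Finset.mem_image.1 this
      exact ⟨c, ⟨hc, h⟩, rfl⟩
  rw [← Nat.card_Ico, ← im2, Finset.card_image_of_injOn]
  exact inj.mono (by intro x; simp; tauto)

/-- columns having a missing entry in `[p+1,q]` -/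
def Ms (w : ℕ) (N : ℕ → ℕ → ℕ) (p q : ℕ) : Finset ℕ :=
  (Finset.range w).filter (fun c => N q c < N p c + (q - p))

def Iv (w : ℕ) (N : ℕ → ℕ → ℕ) (a : ℕ → ℕ) (p q v c : ℕ) : ℕ :=
  if c ∈ Ms w N p q ∧ a q ≤ a v + rk (Ms w N p q) c then 1 else 0

section blocks
variable {r w : ℕ} {h a s : ℕ → ℕ} {l : ℕ} {N : ℕ → ℕ → ℕ}

lemma sp_X (hN : SP r w h a s l N) {k : ℕ} (hk : k < l) (hsr : s (k + 1) ≤ r) {p q : ℕ}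
    (hp : s k ≤ p) (hpq : p ≤ q) (hq : q ≤ s (k + 1)) {c : ℕ} (hc : c < w) :
    N q c ≤ N p c + (q - p) ∧ N p c + (q - p) ≤ N q c + 1 ∧
      (N q c < N p c + (q - p) ↔ ∃ i, p ≤ i ∧ i < q ∧ N (i + 1) c = N i c) := by
  induction q, hpq using Nat.le_induction with
  | base =>
    refine ⟨by omega, by omega, by omega, ?_⟩
    rintro ⟨i, _, _, _⟩; omega
  | succ q hpq ih =>
    obtain ⟨h1, h2, h3, h4⟩ := ih (by omega)
    have b1 := hN.lo q c (by omega) hc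
    have b2 := hN.hi q c (by omega) hc
    by_cases hd : N q c < N p c + (q - p)
    · obtain ⟨i, i1, i2, i3⟩ := h3 hd
      have hnm : N (q + 1) c ≠ N q c := by
        intro e
        have := hN.ord k hk i q (by omega) i2 (by omega) c c hc hc i3 e
        omega
      exact ⟨by omega, by omega, fun _ => ⟨i, i1, by omega, i3⟩, fun _ => by omega⟩
    · refine ⟨by omega, by omega, ?_, ?_⟩
      · intro hh
        exact ⟨q, hpq, by omega, by omega⟩
      · rintro ⟨i, i1, i2, i3⟩
        rcases Nat.lt_or_ge i q with hi | hi
        · exact absurd (h4 ⟨i, i1, hi, i3⟩) hd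
        · have : i = q := by omega
          subst this
          omega

lemma sp_card (hN : SP r w h a s l N) {k : ℕ} (hk : k < l) (hsr : s (k + 1) ≤ r) {p q : ℕ}
    (hp : s k ≤ p) (hpq : p ≤ q) (hq : q ≤ s (k + 1)) :
    (Ms w N p q).card + a p = a q := by
  induction q, hpq using Nat.le_induction with
  | base => simp [Ms]
  | succ q hpq ih =>
    have ih := ih (by omega)
    have hc := hN.cnt q (by omega)
    have hu : Ms w N p (q + 1) =
        Ms w N p q ∪ (Finset.range w).filter (fun c => N (q + 1) c = N q c) := by
      ext c
      simp only [Ms, Finset.mem_filter, Finset.mem_union, Finset.mem_range]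
      constructor
      · rintro ⟨hc, h1⟩
        have := hN.lo q c (by omega) hc
        have := hN.hi q c (by omega) hc
        by_cases e : N (q + 1) c = N q c
        · exact Or.inr ⟨hc, e⟩
        · exact Or.inl ⟨hc, by omega⟩
      · rintro (⟨hc, h1⟩ | ⟨hc, h1⟩)
        · have := hN.hi q c (by omega) hc
          exact ⟨hc, by omega⟩
        · have := (sp_X hN hk hsr hp hpq (by omega) hc).1
          exact ⟨hc, by omega⟩
    have hd : Disjoint (Ms w N p q) ((Finset.range w).filter (fun c => N (q + 1) c = N q c)) := by
      rw [Finset.disjoint_left]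
      intro c h1 h2
      simp only [Ms, Finset.mem_filter, Finset.mem_range] at h1 h2
      obtain ⟨i, i1, i2, i3⟩ := (sp_X hN hk hsr hp hpq (by omega) h1.1).2.2.1 h1.2
      have := hN.ord k hk i q (by omega) i2 (by omega) c c h1.1 h1.1 i3 h2.2
      omega
    rw [hu, Finset.card_union_of_disjoint hd]
    omega

lemma sp_R (hN : SP r w h a s l N) {k : ℕ} (hk : k < l) (hsr : s (k + 1) ≤ r) {v : ℕ}
    (hv : s k ≤ v) (hv' : v ≤ s (k + 1)) {c : ℕ} (hc : c < w) :
    N v c + Iv w N a (s k) (s (k + 1)) v c = N (s k) c + (v - s k) := by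
  have hL := sp_card hN hk hsr hv hv' le_rfl
  obtain ⟨x1, x2, x3⟩ := sp_X hN hk hsr le_rfl hv hv' hc
  have y := @sp_X r w h a s l N hN k hk hsr v (s (k+1)) hv hv' le_rfl
  have x := @sp_X r w h a s l N hN k hk hsr (s k) v le_rfl hv hv'
  by_cases hU : N v c < N (s k) c + (v - s k)
  · obtain ⟨i, i1, i2, i3⟩ := x3.1 hU
    have hcM : c ∈ Ms w N (s k) (s (k + 1)) := by
      simp only [Ms, Finset.mem_filter, Finset.mem_range]
      have := (y hc).1
      exact ⟨hc, by omega⟩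
    have hsub : Ms w N v (s (k+1)) ⊆ (Ms w N (s k) (s (k+1))).filter (fun x => x < c) := by
      intro c' h'
      simp only [Ms, Finset.mem_filter, Finset.mem_range] at h' ⊢
      obtain ⟨j, j1, j2, j3⟩ := (y h'.1).2.2.1 h'.2
      have := (x h'.1).1
      exact ⟨⟨h'.1, by omega⟩, hN.ord k hk i j i1 (by omega) j2 c c' hc h'.1 i3 j3⟩
    have : _ ≤ rk _ _ := Finset.card_le_card hsub
    rw [Iv, if_pos ⟨hcM, by omega⟩]
    omega
  · have : ¬ (c ∈ Ms w N (s k) (s (k + 1)) ∧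
        a (s (k+1)) ≤ a v + rk (Ms w N (s k) (s (k + 1))) c) := by
      rintro ⟨hcM, hle⟩
      have hcL : c ∈ Ms w N v (s (k + 1)) := by
        simp only [Ms, Finset.mem_filter, Finset.mem_range] at hcM ⊢
        exact ⟨hc, by omega⟩
      obtain ⟨j, j1, j2, j3⟩ := (y hc).2.2.1 (Finset.mem_filter.1 hcL).2
      have hlt : rk (Ms w N (s k) (s (k + 1))) c < (Ms w N v (s (k + 1))).card := by
        apply Finset.card_lt_card
        rw [Finset.ssubset_iff_of_subset]
        · exact ⟨c, hcL, by simp⟩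
        · intro c' h'
          simp only [Ms, Finset.mem_filter, Finset.mem_range] at h' ⊢
          obtain ⟨⟨h1, h2⟩, h3⟩ := h'
          refine ⟨h1, ?_⟩
          by_contra hn
          have := (x h1).1
          obtain ⟨i, i1, i2, i3⟩ := (x h1).2.2.1 (by omega)
          have := hN.ord k hk i j i1 (by omega) j2 c' c h1 hc i3 j3
          omega
      omega
    rw [Iv, if_neg this]
    omega

lemma s_lt (hs : ∀ k, k < l → s k < s (k + 1)) : ∀ j k, j < k → k ≤ l → s j < s k := by
  intro j k hjk
  induction k, hjk using Nat.le_induction with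
  | base => intro h; exact hs j (by omega)
  | succ k hk ih => intro h; exact (ih (by omega)).trans (hs k (by omega))

lemma s_le (hs : ∀ k, k < l → s k < s (k + 1)) : ∀ j k, j ≤ k → k ≤ l → s j ≤ s k := by
  intro j k hjk hk
  rcases hjk.lt_or_eq with h | h
  · exact (s_lt hs j k h hk).le
  · rw [h]

lemma blk (hs : ∀ k, k < l → s k < s (k + 1)) (hs0 : s 0 = 0) {v : ℕ} (hv : v < s l) :
    ∃ k, k < l ∧ s k ≤ v ∧ v < s (k + 1) := by
  have ex : ∃ k, v < s k := ⟨l, hv⟩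
  have h1 := Nat.find_spec ex
  have h2 : Nat.find ex ≤ l := Nat.find_le hv
  have h0 : Nat.find ex ≠ 0 := by
    intro h; rw [h, hs0] at h1; omega
  refine ⟨Nat.find ex - 1, by omega, ?_, ?_⟩
  · have := Nat.find_min ex (m := Nat.find ex - 1) (by omega)
    omega
  · have e : Nat.find ex - 1 + 1 = Nat.find ex := by omega
    rw [e]; exact h1

lemma sp_unique (hs : ∀ k, k < l → s k < s (k + 1)) (hs0 : s 0 = 0) (hsl : s l = r)
    {N₁ N₂ : ℕ → ℕ → ℕ} (h1 : SP r w h a s l N₁) (h2 : SP r w h a s l N₂)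
    (e : ∀ k, k ≤ l → ∀ c, c < w → N₁ (s k) c = N₂ (s k) c) :
    ∀ v c, v ≤ r → c < w → N₁ v c = N₂ v c := by
  intro v c hv hc
  rcases hv.lt_or_eq with hv | hv
  · obtain ⟨k, hk, k1, k2⟩ := blk hs hs0 (hsl ▸ hv)
    have hsr : s (k + 1) ≤ r := hsl ▸ s_le hs (k+1) l hk le_rfl
    have r1 := sp_R h1 hk hsr k1 k2.le hc
    have r2 := sp_R h2 hk hsr k1 k2.le hc
    have eM : Ms w N₁ (s k) (s (k + 1)) = Ms w N₂ (s k) (s (k + 1)) := by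
      unfold Ms
      apply Finset.filter_congr
      intro x hx
      rw [e k hk.le x (by simpa using hx), e (k+1) hk x (by simpa using hx)]
    have eI : Iv w N₁ a (s k) (s (k+1)) v c = Iv w N₂ a (s k) (s (k+1)) v c := by
      unfold Iv; rw [eM]
    have := e k hk.le c hc
    omega
  · rw [hv, ← hsl]; exact e l le_rfl c hc

lemma sp_exists (hs : ∀ k, k < l → s k < s (k + 1)) (hs0 : s 0 = 0) (hsl : s l = r) (hl : 1 ≤ l)
    {a' : ℕ → ℕ} (ha' : ∀ i, i < r → a' i ≤ a' (i + 1)) (haa : ∀ k, k ≤ l → a' (s k) = a (s k))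
    (hN : SP r w h a s l N) :
    ∃ N', SP r w h a' s l N' ∧ ∀ k, k ≤ l → ∀ c, c < w → N' (s k) c = N (s k) c := by
  have am : ∀ i j, i ≤ j → j ≤ r → a' i ≤ a' j := by
    intro i j hij
    induction j, hij using Nat.le_induction with
    | base => intro _; exact le_rfl
    | succ j _ ih => intro hj; exact (ih (by omega)).trans (ha' j (by omega))
  have hsr : ∀ k, k < l → s (k + 1) ≤ r := fun k hk => hsl ▸ s_le hs (k+1) l hk le_rfl
  have hcard : ∀ k, k < l → (Ms w N (s k) (s (k+1))).card + a' (s k) = a' (s (k+1)) := by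
    intro k hk
    have := sp_card hN hk (hsr k hk) le_rfl (hs k hk).le le_rfl
    rw [haa k hk.le, haa (k+1) hk]; exact this
  have I0 : ∀ k, k < l → ∀ c, Iv w N a' (s k) (s (k+1)) (s k) c = 0 := by
    intro k hk c
    rw [Iv, if_neg]
    rintro ⟨h1, h2⟩
    have := rk_lt _ h1
    have := hcard k hk
    omega
  have I1 : ∀ k, k < l → ∀ c, c < w →
      N (s (k+1)) c + Iv w N a' (s k) (s (k+1)) (s (k+1)) c = N (s k) c + (s (k+1) - s k) := by
    intro k hk c hc
    have := sp_R hN hk (hsr k hk) (hs k hk).le le_rfl hc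
    rw [← this]
    simp only [Iv, le_add_iff_nonneg_right, zero_le]
  have ex : ∀ v c, ∃ x, c < w → ∀ k, k < l → s k ≤ v → v ≤ s (k+1) →
      x + Iv w N a' (s k) (s (k+1)) v c = N (s k) c + (v - s k) := by
    intro v c
    by_cases hv : ∃ k, k < l ∧ s k ≤ v ∧ v ≤ s (k+1)
    · obtain ⟨k, hk, k1, k2⟩ := hv
      by_cases hx1 : ∃ j, j ≤ l ∧ s j = v
      · obtain ⟨j, hj, rfl⟩ := hx1
        refine ⟨N (s j) c, ?_⟩
        intro hc k' hk' a1 a2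
        rcases Nat.lt_or_ge j k' with h1 | h1
        · have := s_lt hs j k' h1 hk'.le; omega
        · rcases Nat.lt_or_ge (k'+1) j with h2 | h2
          · have := s_lt hs (k'+1) j h2 hj; omega
          · have : j = k' ∨ j = k' + 1 := by omega
            rcases this with rfl | rfl
            · rw [I0 j hk']; omega
            · exact I1 k' hk' c hc
      · refine ⟨N (s k) c + (v - s k) - Iv w N a' (s k) (s (k+1)) v c, ?_⟩
        intro hc k' hk' a1 a2
        have n1 : s k' ≠ v := fun e => hx1 ⟨k', hk'.le, e⟩
        have n2 : s (k'+1) ≠ v := fun e => hx1 ⟨k'+1, hk', e⟩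
        have n3 : s k ≠ v := fun e => hx1 ⟨k, hk.le, e⟩
        have n4 : s (k+1) ≠ v := fun e => hx1 ⟨k+1, hk, e⟩
        have : k' = k := by
          rcases lt_trichotomy k' k with g | g | g
          · have := s_le hs (k'+1) k g hk.le; omega
          · exact g
          · have := s_le hs (k+1) k' g hk'.le; omega
        subst this
        have : Iv w N a' (s k') (s (k'+1)) v c ≤ 1 := by unfold Iv; split_ifs <;> omega
        omega
    · exact ⟨0, fun _ k hk h1 h2 => absurd ⟨k, hk, h1, h2⟩ hv⟩
  choose N' hN' using ex
  have hagree : ∀ k, k ≤ l → ∀ c, c < w → N' (s k) c = N (s k) c := by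
    intro k hk c hc
    rcases hk.lt_or_eq with hk | hk
    · have := hN' (s k) c hc k hk le_rfl (hs k hk).le
      rw [I0 k hk] at this; omega
    · obtain ⟨j, rfl⟩ : ∃ j, l = j + 1 := ⟨l - 1, by omega⟩
      subst hk
      have := hN' (s (j+1)) c hc j (by omega) (hs j (by omega)).le le_rfl
      have := I1 j (by omega) c hc
      omega
  have Imono : ∀ k v c, k < l → v < s (k+1) →
      Iv w N a' (s k) (s (k+1)) v c ≤ Iv w N a' (s k) (s (k+1)) (v+1) c := by
    intro k v c hk hv
    have := ha' v (hv.trans_le (hsr k hk))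
    unfold Iv
    split_ifs with g1 g2 g2
    · omega
    · exact absurd ⟨g1.1, by omega⟩ g2
    · omega
    · omega
  have Ile : ∀ k v c, Iv w N a' (s k) (s (k+1)) v c ≤ 1 := by
    intro k v c; unfold Iv; split_ifs <;> omega
  have miss : ∀ k i c, k < l → s k ≤ i → i < s (k+1) → c < w →
      (N' (i+1) c = N' i c ↔ c ∈ Ms w N (s k) (s (k+1)) ∧
        a' (s (k+1)) - a' (i+1) ≤ rk (Ms w N (s k) (s (k+1))) c ∧
        rk (Ms w N (s k) (s (k+1))) c < a' (s (k+1)) - a' i) := by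
    intro k i c hk h1 h2 hc
    have e1 := hN' i c hc k hk h1 h2.le
    have e2 := hN' (i+1) c hc k hk (by omega) h2
    have := am i (i+1) (by omega) (by have := hsr k hk; omega)
    have := am (i+1) (s (k+1)) (by omega) (hsr k hk)
    unfold Iv at e1 e2
    by_cases hcM : c ∈ Ms w N (s k) (s (k+1))
    · simp only [hcM, true_and] at e1 e2 ⊢
      split_ifs at e1 e2 <;> omega
    · simp only [hcM, false_and, if_false, iff_false] at e1 e2 ⊢
      omega
  refine ⟨N', ⟨⟨?_, ?_, ?_, ?_, ?_⟩, ?_, ?_⟩, hagree⟩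
  · intro c hc
    have := hagree 0 (by omega) c hc
    rw [hs0] at this
    rw [this]; exact hN.zero c hc
  · intro v c hv hc
    obtain ⟨k, hk, k1, k2⟩ := blk hs hs0 (hsl ▸ hv)
    have e1 := hN' v c hc k hk k1 k2.le
    have e2 := hN' (v+1) c hc k hk (by omega) k2
    have := Imono k v c hk k2
    have := Ile k v c
    have := Ile k (v+1) c
    omega
  · intro v c hv hc
    obtain ⟨k, hk, k1, k2⟩ := blk hs hs0 (hsl ▸ hv)
    have e1 := hN' v c hc k hk k1 k2.le
    have e2 := hN' (v+1) c hc k hk (by omega) k2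
    have := Imono k v c hk k2
    omega
  · intro v c c' hv hcc hc'
    rcases hv.lt_or_eq with hv | hv
    · obtain ⟨k, hk, k1, k2⟩ := blk hs hs0 (hsl ▸ hv)
      have e1 := hN' v c (by omega) k hk k1 k2.le
      have e2 := hN' v c' hc' k hk k1 k2.le
      have b0 := hN.anti (s k) c c' (by omega) hcc hc'
      have b1 := hN.anti (s (k+1)) c c' (hsr k hk) hcc hc'
      have hrk := rk_mono (Ms w N (s k) (s (k+1))) hcc
      unfold Iv at e1 e2
      split_ifs at e1 e2 with g1 g2 g2
      · omega
      · have hn : c' ∉ Ms w N (s k) (s (k+1)) := fun hm => g2 ⟨hm, by omega⟩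
        have g1 := g1.1
        simp only [Ms, Finset.mem_filter, Finset.mem_range, not_and, not_lt] at hn g1
        have := hn hc'
        omega
      · omega
      · omega
    · rw [hv, ← hsl, hagree l le_rfl c (by omega), hagree l le_rfl c' hc', hsl]
      exact hN.anti r c c' le_rfl hcc hc'
  · intro c hc
    have := hagree l le_rfl c hc
    rw [hsl] at this
    rw [this]; exact hN.top c hc
  · intro i hi
    obtain ⟨k, hk, k1, k2⟩ := blk hs hs0 (hsl ▸ hi)
    have ef : (Finset.range w).filter (fun c => N' (i+1) c = N' i c) =
        (Ms w N (s k) (s (k+1))).filter (fun c =>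
          a' (s (k+1)) - a' (i+1) ≤ rk (Ms w N (s k) (s (k+1))) c ∧
          rk (Ms w N (s k) (s (k+1))) c < a' (s (k+1)) - a' i) := by
      ext c
      simp only [Finset.mem_filter, Finset.mem_range]
      constructor
      · rintro ⟨hc, e⟩; exact (miss k i c hk k1 k2 hc).1 e
      · intro e
        have hc : c < w := by
          have := e.1
          simp only [Ms, Finset.mem_filter, Finset.mem_range] at this
          exact this.1
        exact ⟨hc, (miss k i c hk k1 k2 hc).2 e⟩
    have q0 := hcard k hk
    have q1 := am (s k) i k1 hi.le
    have q2 := am i (i+1) (by omega) hi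
    have q3 := am (i+1) (s (k+1)) k2 (hsr k hk)
    rw [ef, rk_count _ _ _ (by omega)]
    omega
  · intro k hk i i' h1 h2 h3 c c' hc hc' e e'
    rw [miss k i c hk h1 (by omega) hc] at e
    rw [miss k i' c' hk (by omega) h3 hc'] at e'
    have := am (i+1) i' h2 (by have := hsr k hk; omega)
    by_contra hn
    have := rk_mono (Ms w N (s k) (s (k+1))) (not_lt.1 hn)
    omega

end blocks

lemma finite_ssyt (r w : ℕ) (μ : ℕ → ℕ) (hp : IsPartition r μ) (hsub : ∀ i, μ i ≤ w) :
    {T : ℕ → ℕ → ℕ | IsSSYT μ r T ∧ ZeroOutside μ T}.Finite := by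
  let F : (ℕ → ℕ → ℕ) → (Fin r → Fin w → Fin (r+1)) := fun T i j => Fin.ofNat (r+1) (T i j)
  apply Set.Finite.of_injOn (f := F) (t := Set.univ) (fun _ _ => Set.mem_univ _) ?_ Set.finite_univ
  rintro T ⟨hT, hz⟩ T' ⟨hT', hz'⟩ e
  funext i j
  by_cases hj : j < μ i
  · have hi : i < r := by
      by_contra hn
      have := hp.2 i (by omega)
      omega
    have hjw : j < w := hj.trans_le (hsub i)
    have := congrFun (congrFun e ⟨i, hi⟩) ⟨j, hjw⟩
    have := congrArg Fin.val this
    simp only [F, Fin.ofNat] at this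
    have b1 := (hT.1 i j hj).2
    have b2 := (hT'.1 i j hj).2
    rwa [Nat.mod_eq_of_lt (by omega), Nat.mod_eq_of_lt (by omega)] at this
  · rw [hz i j hj, hz' i j hj]

lemma card_le_aux {r w : ℕ} {μ : ℕ → ℕ} (hp : IsPartition r μ) (hsub : ∀ i, μ i ≤ w)
    {a a' s : ℕ → ℕ} {l : ℕ} (hs : ∀ k, k < l → s k < s (k + 1)) (hs0 : s 0 = 0) (hsl : s l = r)
    (hl : 1 ≤ l) (ha' : ∀ i, i < r → a' i ≤ a' (i + 1)) (haa : ∀ k, k ≤ l → a' (s k) = a (s k)) :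
    {T : ℕ → ℕ → ℕ | IsSSYT μ r T ∧ ZeroOutside μ T ∧ SP r w (colH μ r) a s l (Nf μ r T)}.ncard ≤
    {T : ℕ → ℕ → ℕ | IsSSYT μ r T ∧ ZeroOutside μ T ∧ SP r w (colH μ r) a' s l (Nf μ r T)}.ncard := by
  have ex : ∀ T : ℕ → ℕ → ℕ, ∃ T' : ℕ → ℕ → ℕ,
      (IsSSYT μ r T ∧ ZeroOutside μ T ∧ SP r w (colH μ r) a s l (Nf μ r T)) →
      (IsSSYT μ r T' ∧ ZeroOutside μ T' ∧ SP r w (colH μ r) a' s l (Nf μ r T')) ∧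
      ∀ k, k ≤ l → ∀ c, c < w → Nf μ r T' (s k) c = Nf μ r T (s k) c := by
    intro T
    by_cases hT : IsSSYT μ r T ∧ ZeroOutside μ T ∧ SP r w (colH μ r) a s l (Nf μ r T)
    · obtain ⟨N', h1, h2⟩ := sp_exists hs hs0 hsl hl ha' haa hT.2.2
      obtain ⟨T', t1, t2, t3⟩ := exists_of_gp hp hsub h1.toGP
      refine ⟨T', fun _ => ⟨⟨t1, t2, gp_Nf hp t1, ?_, ?_⟩, ?_⟩⟩
      · intro i hi
        rw [← h1.cnt i hi]
        congr 2
        apply Finset.filter_congr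
        intro c hc
        rw [t3 _ _ hi (by simpa using hc), t3 _ _ hi.le (by simpa using hc)]
      · intro k hk i i' g1 g2 g3 c c' hc hc' e e'
        have hsr : s (k + 1) ≤ r := hsl ▸ s_le hs (k+1) l hk le_rfl
        rw [t3 _ _ (by omega) hc, t3 _ _ (by omega) hc] at e
        rw [t3 _ _ (by omega) hc', t3 _ _ (by omega) hc'] at e'
        exact h1.ord k hk i i' g1 g2 g3 c c' hc hc' e e'
      · intro k hk c hc
        have hsr : s k ≤ r := hsl ▸ s_le hs k l hk le_rfl
        rw [t3 _ _ hsr hc, h2 k hk c hc]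
    · exact ⟨T, fun h => absurd h hT⟩
  choose Φ hΦ using ex
  refine Set.ncard_le_ncard_of_injOn Φ ?_ ?_
    ((finite_ssyt r w μ hp hsub).subset (fun T hT => ⟨hT.1, hT.2.1⟩))
  · intro T hT
    exact (hΦ T hT).1
  · intro T hT T' hT' e
    apply Nf_inj hp hsub hT.1 hT'.1 hT.2.1 hT'.2.1
    apply sp_unique hs hs0 hsl hT.2.2 hT'.2.2
    intro k hk c hc
    rw [← (hΦ T hT).2 k hk c hc, ← (hΦ T' hT').2 k hk c hc, e]

lemma setB_eq {n r : ℕ} (μ : ℕ → ℕ) (hp : IsPartition r μ)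
    (hsub : ∀ i, μ i ≤ n - 1)
    (a : ℕ → ℕ) (ha0 : a 0 = 1) (har : a r = n) (hamono : ∀ i, i < r → a i < a (i + 1))
    (ℓ : ℕ) 
    (s : ℕ → ℕ) (hs0 : s 0 = 0) (hsl : s ℓ = r) (hsmono : ∀ k, k < ℓ → s k < s (k + 1)) :
    {T : ℕ → ℕ → ℕ | IsSSYT μ r T ∧ ZeroOutside μ T ∧
          (∀ i, 1 ≤ i → i ≤ r → wgt μ T i = n - 1 - (a i - a (i - 1))) ∧
          (∀ i, 1 ≤ i → i ≤ r - 1 → (∀ k, 1 ≤ k → k ≤ ℓ - 1 → s k ≠ i) →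
            HasIIStrip μ (n - 1) T i)} =
    {T : ℕ → ℕ → ℕ | IsSSYT μ r T ∧ ZeroOutside μ T ∧
      SP r (n - 1) (colH μ r) a s ℓ (Nf μ r T)} := by
  have am : ∀ i j, i ≤ j → j ≤ r → a i ≤ a j := by
    intro i j hij
    induction j, hij using Nat.le_induction with
    | base => intro _; exact le_rfl
    | succ j _ ih => intro hj; exact (ih (by omega)).trans (hamono j (by omega)).le
  ext T
  simp only [Set.mem_ofPred_eq]
  constructor
  · rintro ⟨hT, hz, hw, hst⟩
    have cnt : ∀ i, i < r → ((Finset.range (n - 1)).filter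
        (fun c => Nf μ r T (i + 1) c = Nf μ r T i c)).card + a i = a (i + 1) := by
      intro i hi
      have h1 := wgt_add hp hsub hT i hi
      have h2 := hw (i + 1) (by omega) hi
      have h3 := am 0 i (by omega) hi.le
      have h4 := am (i + 1) r hi le_rfl
      have h5 := hamono i hi
      simp only [Nat.add_sub_cancel] at h2
      omega
    refine ⟨hT, hz, gp_Nf hp hT, cnt, ?_⟩
    intro k hk i i' h1 h2 h3
    have hsr : s (k + 1) ≤ r := hsl ▸ s_le hsmono (k+1) ℓ hk le_rfl
    have adj : ∀ i, s k ≤ i → i + 1 < s (k + 1) → ∀ c c', c < n - 1 → c' < n - 1 →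
        Nf μ r T (i + 1) c = Nf μ r T i c →
        Nf μ r T (i + 2) c' = Nf μ r T (i + 1) c' → c' < c := by
      intro i g1 g2
      rw [← strip_iff hp hT i (by omega)]
      apply hst (i + 1) (by omega) (by omega)
      intro j j1 j2 e
      rcases Nat.lt_or_ge k j with g | g
      · have := s_le hsmono (k+1) j g (by omega); omega
      · have := s_le hsmono j k g hk.le; omega
    induction i', h2 using Nat.le_induction with
    | base => exact adj i h1 h3
    | succ i' hi' ih =>
      intro c c' hc hc' e e'
      have hne : ((Finset.range (n - 1)).filter
        (fun c => Nf μ r T (i' + 1) c = Nf μ r T i' c)).Nonempty := by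
        rw [← Finset.card_pos]
        have := cnt i' (by omega)
        have := hamono i' (by omega)
        omega
      obtain ⟨d, hd⟩ := hne
      simp only [Finset.mem_filter, Finset.mem_range] at hd
      have q1 := ih (by omega) c d hc hd.1 e hd.2
      have q2 := adj i' (by simp at hi'; omega) h3 d c' hd.1 hc' hd.2 e'
      omega
  · rintro ⟨hT, hz, hS⟩
    refine ⟨hT, hz, ?_, ?_⟩
    · intro i h1 h2
      obtain ⟨j, rfl⟩ : ∃ j, i = j + 1 := ⟨i - 1, by omega⟩
      have := wgt_add hp hsub hT j h2
      have := hS.cnt j h2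
      simp only [Nat.add_sub_cancel]
      omega
    · intro i h1 h2 h3
      obtain ⟨j, rfl⟩ : ∃ j, i = j + 1 := ⟨i - 1, by omega⟩
      rw [strip_iff hp hT j (by omega)]
      obtain ⟨k, hk, k1, k2⟩ := blk hsmono hs0 (v := j) (by omega)
      have : s (k + 1) ≠ j + 1 := by
        rcases Nat.lt_or_ge (k + 1) ℓ with g | g
        · exact h3 (k+1) (by omega) (by omega)
        · have : k + 1 = ℓ := by omega
          rw [this, hsl]; omega
      exact hS.ord k hk j (j+1) k1 (by omega) (by omega)

/-- the coarse version of `a`, constant on blocks -/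
def aC (a s : ℕ → ℕ) (l i : ℕ) : ℕ := a (s (Nat.findGreatest (fun k => s k ≤ i) l))

lemma aC_eq {a s : ℕ → ℕ} {l : ℕ} (hs : ∀ k, k < l → s k < s (k + 1)) {k i : ℕ} (hk : k ≤ l)
    (h1 : s k ≤ i) (h2 : k < l → i < s (k + 1)) : aC a s l i = a (s k) := by
  have : Nat.findGreatest (fun k => s k ≤ i) l = k := by
    rw [Nat.findGreatest_eq_iff]
    refine ⟨hk, fun _ => h1, ?_⟩
    intro j hj hjl hc
    have := s_le hs (k+1) j hj hjl
    have := h2 (by omega)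
    omega
  rw [aC, this]

lemma aC_s {a s : ℕ → ℕ} {l : ℕ} (hs : ∀ k, k < l → s k < s (k + 1)) {k : ℕ} (hk : k ≤ l) :
    aC a s l (s k) = a (s k) := aC_eq hs hk le_rfl (hs k)

lemma setA_eq {n r : ℕ} (μ : ℕ → ℕ) (hp : IsPartition r μ)
    (hsub : ∀ i, μ i ≤ n - 1)
    (a : ℕ → ℕ) (ha0 : a 0 = 1) (har : a r = n) (am : ∀ i j, i ≤ j → j ≤ r → a i ≤ a j)
    (ℓ : ℕ) 
    (s : ℕ → ℕ) (hs0 : s 0 = 0) (hsl : s ℓ = r) (hsmono : ∀ k, k < ℓ → s k < s (k + 1)) :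
    {T : ℕ → ℕ → ℕ | IsSSYT μ r T ∧ ZeroOutside μ T ∧
        (∀ k, 1 ≤ k → k ≤ ℓ → wgt μ T (s k) = n - 1 - (a (s k) - a (s (k - 1)))) ∧
        (∀ i, 1 ≤ i → i ≤ r → (∀ k, 1 ≤ k → k ≤ ℓ → s k ≠ i) → wgt μ T i = n - 1)} =
    {T : ℕ → ℕ → ℕ | IsSSYT μ r T ∧ ZeroOutside μ T ∧
      SP r (n - 1) (colH μ r) (aC a s ℓ) s ℓ (Nf μ r T)} := by
  have hsr : ∀ k, k ≤ ℓ → s k ≤ r := fun k hk => hsl ▸ s_le hsmono k ℓ hk le_rfl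
  have inner : ∀ k i, k < ℓ → s k ≤ i → i + 1 < s (k+1) → aC a s ℓ (i+1) = aC a s ℓ i := by
    intro k i hk h1 h2
    rw [aC_eq hsmono hk.le h1 (by omega), aC_eq hsmono hk.le (by omega) (by omega)]
  have outer : ∀ k i, k < ℓ → i + 1 = s (k+1) →
      aC a s ℓ (i+1) = a (s (k+1)) ∧ aC a s ℓ i = a (s k) := by
    intro k i hk h2
    have := hsmono k hk
    rw [h2]
    exact ⟨aC_s hsmono hk, aC_eq hsmono hk.le (by omega) (by omega)⟩
  ext T
  simp only [Set.mem_ofPred_eq]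
  constructor
  · rintro ⟨hT, hz, hw1, hw2⟩
    have cnt : ∀ i, i < r → ((Finset.range (n - 1)).filter
        (fun c => Nf μ r T (i + 1) c = Nf μ r T i c)).card + aC a s ℓ i = aC a s ℓ (i + 1) := by
      intro i hi
      obtain ⟨k, hk, k1, k2⟩ := blk hsmono hs0 (v := i) (by omega)
      have h1 := wgt_add hp hsub hT i hi
      rcases Nat.lt_or_ge (i + 1) (s (k+1)) with g | g
      · rw [inner k i hk k1 g]
        have := hw2 (i+1) (by omega) hi (by
          intro j j1 j2 e
          rcases Nat.lt_or_ge k j with g | g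
          · have := s_le hsmono (k+1) j g (by omega); omega
          · have := s_le hsmono j k g hk.le; omega)
        omega
      · have e : i + 1 = s (k+1) := by omega
        obtain ⟨o1, o2⟩ := outer k i hk e
        have h2 := hw1 (k+1) (by omega) hk
        simp only [Nat.add_sub_cancel] at h2
        rw [← e] at h2 o1
        have h3 := am 0 (s k) (by omega) (hsr k hk.le)
        have h4 := am (i + 1) r hi le_rfl
        have h5 := am (s k) (i + 1) (by omega) hi
        omega
    refine ⟨hT, hz, gp_Nf hp hT, cnt, ?_⟩
    intro k hk i i' h1 h2 h3 c c' hc hc' e e'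
    have := hsr (k+1) hk
    have h4 := cnt i (by omega)
    rw [inner k i hk h1 (by omega)] at h4
    have h5 : ((Finset.range (n - 1)).filter
        (fun c => Nf μ r T (i + 1) c = Nf μ r T i c)).card = 0 := by omega
    rw [Finset.card_eq_zero] at h5
    have : c ∈ ((Finset.range (n - 1)).filter
        (fun c => Nf μ r T (i + 1) c = Nf μ r T i c)) := by simp [hc, e]
    rw [h5] at this
    simp at this
  · rintro ⟨hT, hz, hS⟩
    refine ⟨hT, hz, ?_, ?_⟩
    · intro k h1 h2
      obtain ⟨j, rfl⟩ : ∃ j, k = j + 1 := ⟨k - 1, by omega⟩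
      have := hsmono j h2
      obtain ⟨i, hi⟩ : ∃ i, i + 1 = s (j+1) := ⟨s (j+1) - 1, by omega⟩
      have := hsr (j+1) h2
      have h3 := wgt_add hp hsub hT i (by omega)
      have h4 := hS.cnt i (by omega)
      obtain ⟨o1, o2⟩ := outer j i h2 hi
      simp only [Nat.add_sub_cancel]
      rw [← hi] at o1 ⊢
      omega
    · intro i h1 h2 h3
      obtain ⟨j, rfl⟩ : ∃ j, i = j + 1 := ⟨i - 1, by omega⟩
      obtain ⟨k, hk, k1, k2⟩ := blk hsmono hs0 (v := j) (by omega)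
      have := h3 (k+1) (by omega) hk
      have h4 := wgt_add hp hsub hT j h2
      have h5 := hS.cnt j h2
      rw [inner k j hk k1 (by omega)] at h5
      omega

/-- For fixed `1 = a₀ < a₁ < … < a_{r-1} < a_r = n` and a chain `0 = s₀ < … < s_ℓ = r`:
the number of SSYTs of shape `μ ⊆ (n-1)^r` with `w_{s_j} = n-1-(a_{s_j}-a_{s_{j-1}})` and
`w_i = n-1` otherwise equals the number of SSYTs of shape `μ` with
`w_i = n-1-(a_i-a_{i-1})` for all `i` containing an `(i,i+1)`-strip for every
`i ∈ {1,…,r-1} \ {s₁,…,s_{ℓ-1}}`. -/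
theorem stmt14 (n r : ℕ) (hrn : r < n) (μ : ℕ → ℕ) (hp : IsPartition r μ)
    (hsub : ∀ i, μ i ≤ n - 1)
    (a : ℕ → ℕ) (ha0 : a 0 = 1) (har : a r = n) (hamono : ∀ i, i < r → a i < a (i + 1))
    (ℓ : ℕ) (hl1 : 1 ≤ ℓ) (hlr : ℓ ≤ r)
    (s : ℕ → ℕ) (hs0 : s 0 = 0) (hsl : s ℓ = r) (hsmono : ∀ k, k < ℓ → s k < s (k + 1)) :
    {T : ℕ → ℕ → ℕ | IsSSYT μ r T ∧ ZeroOutside μ T ∧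
        (∀ k, 1 ≤ k → k ≤ ℓ → wgt μ T (s k) = n - 1 - (a (s k) - a (s (k - 1)))) ∧
        (∀ i, 1 ≤ i → i ≤ r → (∀ k, 1 ≤ k → k ≤ ℓ → s k ≠ i) → wgt μ T i = n - 1)}.ncard
      = {T : ℕ → ℕ → ℕ | IsSSYT μ r T ∧ ZeroOutside μ T ∧
          (∀ i, 1 ≤ i → i ≤ r → wgt μ T i = n - 1 - (a i - a (i - 1))) ∧
          (∀ i, 1 ≤ i → i ≤ r - 1 → (∀ k, 1 ≤ k → k ≤ ℓ - 1 → s k ≠ i) →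
            HasIIStrip μ (n - 1) T i)}.ncard := by
  have am : ∀ i j, i ≤ j → j ≤ r → a i ≤ a j := by
    intro i j hij
    induction j, hij using Nat.le_induction with
    | base => intro _; exact le_rfl
    | succ j _ ih => intro hj; exact (ih (by omega)).trans (hamono j (by omega)).le
  rw [setA_eq μ hp hsub a ha0 har am ℓ s hs0 hsl hsmono,
    setB_eq μ hp hsub a ha0 har hamono ℓ s hs0 hsl hsmono]
  apply le_antisymm
  · exact card_le_aux hp hsub hsmono hs0 hsl hl1 (fun i hi => (hamono i hi).le)
      (fun k hk => (aC_s hsmono hk).symm)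
  · refine card_le_aux hp hsub hsmono hs0 hsl hl1 ?_ (fun k hk => aC_s hsmono hk)
    intro i hi
    unfold aC
    apply am
    · exact s_le hsmono _ _ (Nat.findGreatest_mono_left (fun k hk => Nat.le_succ_of_le hk) _)
        (Nat.findGreatest_le _)
    · rw [← hsl]
      exact s_le hsmono _ _ (Nat.findGreatest_le _) le_rfl
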